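/- arXiv:2210.05352 — 3 statements merged into one kernel-verified Lean document; each statement's English description precedes it below -/
import Mathlib

section
/- Let α, β be real numbers, let u ∈ ℋ, and define on the interior indices 𝓘: w := −(α²/2) Δ₁ u − (β²/2) Δ₂ u − αβ D₁,₀ D₂,₀ u + ((α²+β²)/8) Δ₁ Δ₂ u. Then 4‖w‖²_{ℓ²(𝓘)} + β²·((α²+β²)/2)·∑_{k∈ℤ} ((Δ₂ u)_{0,k})² ≤ 2(α²+β²)·( α²‖Δ₁ u‖²_{ℓ²(𝓘)} + β²‖Δ₂ u‖²_{ℓ²(𝓘)} + (α²+β²)‖D₁₊ D₂₊ u‖²_{ℓ²(𝓘)} ). -/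
noncomputable section

/-- Forward difference in the first variable. -/
def D1p (u : ℤ → ℤ → ℝ) : ℤ → ℤ → ℝ := fun j k => u (j + 1) k - u j k
/-- Backward difference in the first variable. -/
def D1m (u : ℤ → ℤ → ℝ) : ℤ → ℤ → ℝ := fun j k => u j k - u (j - 1) k
/-- Forward difference in the second variable. -/
def D2p (u : ℤ → ℤ → ℝ) : ℤ → ℤ → ℝ := fun j k => u j (k + 1) - u j k
/-- Backward difference in the second variable. -/
def D2m (u : ℤ → ℤ → ℝ) : ℤ → ℤ → ℝ := fun j k => u j k - u j (k - 1)
/-- Centered difference in the first variable. -/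
def D10 (u : ℤ → ℤ → ℝ) : ℤ → ℤ → ℝ := fun j k => (D1p u j k + D1m u j k) / 2
/-- Centered difference in the second variable. -/
def D20 (u : ℤ → ℤ → ℝ) : ℤ → ℤ → ℝ := fun j k => (D2p u j k + D2m u j k) / 2
/-- Discrete Laplacian in the first variable. -/
def L1 (u : ℤ → ℤ → ℝ) : ℤ → ℤ → ℝ := D1p (D1m u)
/-- Discrete Laplacian in the second variable. -/
def L2 (u : ℤ → ℤ → ℝ) : ℤ → ℤ → ℝ := D2p (D2m u)

/-- Squared ℓ²(ℤ²) norm. -/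
def sqZ (u : ℤ → ℤ → ℝ) : ℝ := ∑' p : ℤ × ℤ, (u p.1 p.2) ^ 2
/-- ℓ²(ℤ²) scalar product. -/
def ipZ (u v : ℤ → ℤ → ℝ) : ℝ := ∑' p : ℤ × ℤ, u p.1 p.2 * v p.1 p.2

/-- Squared ℓ²(𝓘) norm over the interior indices 𝓘 = ℕ × ℤ of the half-space grid. -/
def sqH (u : ℤ → ℤ → ℝ) : ℝ := ∑' p : ℕ × ℤ, (u (p.1 : ℤ) p.2) ^ 2
/-- ℓ²(𝓘) scalar product over the interior indices 𝓘 = ℕ × ℤ. -/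
def ipH (u v : ℤ → ℤ → ℝ) : ℝ := ∑' p : ℕ × ℤ, u (p.1 : ℤ) p.2 * v (p.1 : ℤ) p.2
/-- Membership in ℋ : square-summable on the half-space grid and satisfying the
extrapolation (Neumann) boundary condition `u (-1) k = u 0 k`. -/
def memH (u : ℤ → ℤ → ℝ) : Prop :=
  (∀ k : ℤ, u (-1) k = u 0 k) ∧ Summable (fun p : ℕ × ℤ => (u (p.1 : ℤ) p.2) ^ 2)

/-- Squared ℓ²(𝔦) norm over the interior indices 𝔦 = ℕ × ℕ of the quarter-space grid. -/
def sqQ (u : ℤ → ℤ → ℝ) : ℝ := ∑' p : ℕ × ℕ, (u (p.1 : ℤ) (p.2 : ℤ)) ^ 2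
/-- ℓ²(𝔦) scalar product over the interior indices 𝔦 = ℕ × ℕ. -/
def ipQ (u v : ℤ → ℤ → ℝ) : ℝ :=
  ∑' p : ℕ × ℕ, u (p.1 : ℤ) (p.2 : ℤ) * v (p.1 : ℤ) (p.2 : ℤ)
/-- Membership in 𝔥 : square-summable on the quarter-space grid, satisfying the
extrapolation boundary conditions on both sides and the corner condition. -/
def memQ (u : ℤ → ℤ → ℝ) : Prop :=
  (∀ k : ℤ, -1 ≤ k → u (-1) k = u 0 k) ∧ (∀ j : ℤ, 0 ≤ j → u j (-1) = u j 0) ∧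
    Summable (fun p : ℕ × ℕ => (u (p.1 : ℤ) (p.2 : ℤ)) ^ 2)

/-- The skew-selfadjoint part `v` in the decomposition of the Lax-Wendroff scheme. -/
def vop (α β : ℝ) (u : ℤ → ℤ → ℝ) : ℤ → ℤ → ℝ :=
  fun j k => -α * D10 u j k - β * D20 u j k
/-- The selfadjoint part `w` in the decomposition of the Lax-Wendroff scheme. -/
def wop (α β : ℝ) (u : ℤ → ℤ → ℝ) : ℤ → ℤ → ℝ :=
  fun j k => -(α ^ 2 / 2) * L1 u j k - (β ^ 2 / 2) * L2 u j k
    - α * β * D10 (D20 u) j k + ((α ^ 2 + β ^ 2) / 8) * L1 (L2 u) j k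

def FF (a b xm xz xp gm gz gp : ℝ) : ℝ :=
  ((-1/2)*b*b)*((xp-2*xz+xm)*(xp-2*xz+xm)) +
  (1/4*a*a)*(gm*gp) + (7/4*a*a)*(gp*gp) + (-2*a*a)*(gp*gz) +
  (-1/2*a*b)*(gm*xp) + (1/2*a*b)*(gp*xm) + (-1*a*b)*(gp*xz) +
  (1*a*b)*(gz*xp) + (-1/4*b*b)*(gm*gp) + (1/2*b*b)*(gm*xp) +
  (5/4*b*b)*(gp*gp) + (-1*b*b)*(gp*gz) + (1/2*b*b)*(gp*xm) +
  (3*b*b)*(gp*xp) + (-2*b*b)*(gp*xz) + (-2*b*b)*(gz*xp)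

def GG (a b xm xz fm fz gm gz : ℝ) : ℝ :=
  (1/2*a*a)*(fm*fm) + (-5/4*a*a)*(fm*fz) + (1/4*a*a)*(fm*gm) +
  (1/4*a*a)*(fm*gz) + (-1/2*a*a)*(fz*fz) + (1/4*a*a)*(fz*gm) +
  (1/4*a*a)*(fz*gz) + (1/4*a*a)*(gm*gm) + (-5/4*a*a)*(gm*gz) +
  (5/4*a*a)*(gz*gz) + (1*a*b)*(fm*fm) + (-5/2*a*b)*(fm*fz) +
  (1/2*a*b)*(fm*gz) + (1/2*a*b)*(fm*xm) + (-1*a*b)*(fm*xz) +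
  (3/2*a*b)*(fz*fz) + (-1/2*a*b)*(fz*gm) + (1/2*a*b)*(fz*xz) +
  (-1/2*a*b)*(gm*gm) + (3/2*a*b)*(gm*gz) + (-1/2*a*b)*(gm*xm) +
  (1*a*b)*(gm*xz) + (-1*a*b)*(gz*gz) + (-1/2*a*b)*(gz*xz) +
  (3/4*b*b)*(fm*fz) + (-1/4*b*b)*(fm*gm) + (1/4*b*b)*(fm*gz) +
  (-1/2*b*b)*(fm*xm) + (1*b*b)*(fm*xz) + (-5/2*b*b)*(fz*fz) +
  (1/4*b*b)*(fz*gm) + (-1/4*b*b)*(fz*gz) + (1*b*b)*(fz*xm) +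
  (-5/2*b*b)*(fz*xz) + (1/4*b*b)*(gm*gm) + (-1/4*b*b)*(gm*gz) +
  (1/2*b*b)*(gm*xm) + (-1*b*b)*(gm*xz) + (3/4*b*b)*(gz*gz) +
  (-1*b*b)*(gz*xm) + (5/2*b*b)*(gz*xz)

def Fd (a b : ℝ) (u : ℤ → ℤ → ℝ) (j k : ℤ) : ℝ :=
  FF a b (u j (k-1)) (u j k) (u j (k+1)) (D1m u j (k-1)) (D1m u j k) (D1m u j (k+1))

def Gd (a b : ℝ) (u : ℤ → ℤ → ℝ) (j k : ℤ) : ℝ :=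
  GG a b (u j (k-1)) (u j k) (D1p u j (k-1)) (D1p u j k) (D1m u j (k-1)) (D1m u j k)

theorem real_key (a b xm xz xp fm fz fp gm gz gp w : ℝ)
    (hw : w = -(a^2/2)*(fz-gz) - (b^2/2)*(xp-2*xz+xm) - a*b*((fp+gp-fm-gm)/4)
      + ((a^2+b^2)/8)*((fp-gp)-2*(fz-gz)+(fm-gm))) :
    4*w^2 + (a^2+b^2)*((FF a b (xm+fm) (xz+fz) (xp+fp) fm fz fp - FF a b xm xz xp gm gz gp)
      + (GG a b xz xp fz fp gz gp - GG a b xm xz fm fz gm gz)) ≤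
    2*(a^2+b^2)*(a^2*(fz-gz)^2 + b^2*(xp-2*xz+xm)^2 + (a^2+b^2)*(fp-fz)^2) := by
  have key : 2*(a^2+b^2)*(a^2*(fz-gz)^2 + b^2*(xp-2*xz+xm)^2 + (a^2+b^2)*(fp-fz)^2) -
     (4*w^2 + (a^2+b^2)*((FF a b (xm+fm) (xz+fz) (xp+fp) fm fz fp - FF a b xm xz xp gm gz gp)
      + (GG a b xz xp fz fp gz gp - GG a b xm xz fm fz gm gz))) =
      (b*(a*((fz-gz)-((fp-gp)-2*(fz-gz)+(fm-gm))/4)+b*(fp+gp-fm-gm)/4)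
       - a*(b*((xp-2*xz+xm)-((fp-gp)-2*(fz-gz)+(fm-gm))/4)+a*(fp+gp-fm-gm)/4))^2
      + (a^2+b^2)*((b*((2*xp+fp)-2*(2*xz+fz)+(2*xm+fm))/2 - a*((fp-fm)/2))^2
       + (a*((fp-gp)+(fz-gz)) - b*((fp+gp)-(fz+gz)))^2/4
       + (a*((fp+gp)-2*(fz+gz)+(fm+gm)) - 2*b*(((fp-gp)-(fm-gm))/2))^2/8) := by
    subst hw
    unfold FF GG
    ring
  rw [← sub_nonneg, key]
  positivity

theorem pt_key (a b : ℝ) (u : ℤ → ℤ → ℝ) (j k : ℤ) :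
    4*(wop a b u j k)^2 + (a^2+b^2)*((Fd a b u (j+1) k - Fd a b u j k)
      + (Gd a b u j (k+1) - Gd a b u j k)) ≤
    2*(a^2+b^2)*(a^2*(L1 u j k)^2 + b^2*(L2 u j k)^2 + (a^2+b^2)*(D1p (D2p u) j k)^2) := by
  have h := real_key a b (u j (k-1)) (u j k) (u j (k+1))
    (D1p u j (k-1)) (D1p u j k) (D1p u j (k+1)) (D1m u j (k-1)) (D1m u j k) (D1m u j (k+1))
    (wop a b u j k) (by
      simp only [wop, L1, L2, D1p, D1m, D2p, D2m, D10, D20, add_sub_cancel_right]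
      ring)
  have e1 : ∀ k, u j k + D1p u j k = u (j+1) k := fun k => by simp [D1p]
  have e2 : ∀ k, D1m u (j+1) k = D1p u j k := fun k => by simp [D1p, D1m]
  have e3 : D1p u j k - D1m u j k = L1 u j k := by simp [D1p, D1m, L1]
  have e4 : u j (k+1) - 2 * u j k + u j (k-1) = L2 u j k := by
    simp only [L2, D2p, D2m, add_sub_cancel_right]; ring
  have e5 : D1p u j (k+1) - D1p u j k = D1p (D2p u) j k := by
    simp only [D1p, D2p]; ring
  rw [e1, e1, e1, e3, e4, e5] at h
  simpa only [Fd, Gd, e2, add_sub_cancel_right] using h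

def Sq (v : ℤ → ℤ → ℝ) : Prop := Summable (fun p : ℕ × ℤ => (v (p.1 : ℤ) p.2) ^ 2)

theorem Sq.mul {v w : ℤ → ℤ → ℝ} (hv : Sq v) (hw : Sq w) :
    Summable (fun p : ℕ × ℤ => v (p.1 : ℤ) p.2 * w (p.1 : ℤ) p.2) := by
  refine Summable.of_norm_bounded (Summable.add hv hw) fun p => ?_
  rw [Real.norm_eq_abs, abs_le]
  constructor <;> nlinarith [sq_nonneg (v p.1 p.2 + w p.1 p.2), sq_nonneg (v p.1 p.2 - w p.1 p.2),
    sq_nonneg (v p.1 p.2), sq_nonneg (w p.1 p.2)]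

theorem Sq.add {v w : ℤ → ℤ → ℝ} (hv : Sq v) (hw : Sq w) : Sq (fun j k => v j k + w j k) := by
  have := (Summable.add hv hw).add ((hv.mul hw).mul_left 2)
  refine this.congr fun p => ?_
  ring

theorem Sq.smul {v : ℤ → ℤ → ℝ} (c : ℝ) (hv : Sq v) : Sq (fun j k => c * v j k) := by
  refine (Summable.mul_left (c^2) hv).congr fun p => ?_
  ring

theorem Sq.sub {v w : ℤ → ℤ → ℝ} (hv : Sq v) (hw : Sq w) : Sq (fun j k => v j k - w j k) := by
  have := hv.add (hw.smul (-1))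
  refine Summable.congr this fun p => ?_
  ring

theorem Sq.shk {v : ℤ → ℤ → ℝ} (c : ℤ) (hv : Sq v) : Sq (fun j k => v j (k + c)) := by
  have := Summable.comp_injective hv
    ((Equiv.refl ℕ).prodCongr (Equiv.addRight c : ℤ ≃ ℤ)).injective
  exact this.congr fun p => by simp

theorem Sq.shkm {v : ℤ → ℤ → ℝ} (hv : Sq v) : Sq (fun j k => v j (k - 1)) := hv.shk (-1)

theorem shj_inj : Function.Injective (fun p : ℕ × ℤ => (p.1 + 1, p.2)) := by
  rintro ⟨a, b⟩ ⟨c, d⟩ h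
  simpa using h

theorem Sq.shj {v : ℤ → ℤ → ℝ} (hv : Sq v) : Sq (fun j k => v (j + 1) k) := by
  have := Summable.comp_injective hv shj_inj
  exact this.congr fun p => by simp

theorem Sq.shjm {v : ℤ → ℤ → ℝ} (hv : Sq v) (h0 : ∀ k, v (-1) k = v 0 k) :
    Sq (fun j k => v (j - 1) k) := by
  have h1 : Summable (fun p : ℕ × ℤ => if p.1 = 0 then 0 else (v ((p.1 : ℤ) - 1) p.2)^2) := by
    rw [← shj_inj.summable_iff]
    · exact Summable.congr hv fun p => by simp
    · rintro ⟨j, k⟩ h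
      rcases j with _ | j
      · simp
      · exact absurd ⟨(j, k), rfl⟩ h
  refine Summable.of_nonneg_of_le (fun p => sq_nonneg _) (fun p => ?_) (Summable.add h1 hv)
  rcases p with ⟨j, k⟩
  rcases j with _ | j
  · simp [h0]
  · simp; positivity

theorem tele_k {h : ℤ → ℤ → ℝ} :
    ∑' p : ℕ × ℤ, h p.1 (p.2 + 1) = ∑' p : ℕ × ℤ, h p.1 p.2 :=
  ((Equiv.refl ℕ).prodCongr (Equiv.addRight 1 : ℤ ≃ ℤ)).tsum_eq
    (fun p : ℕ × ℤ => h p.1 p.2)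

theorem tele_j {h : ℤ → ℤ → ℝ} (hs : Summable (fun p : ℕ × ℤ => h p.1 p.2)) :
    Summable (fun p : ℕ × ℤ => h (p.1 + 1) p.2) ∧
    ∑' p : ℕ × ℤ, h (p.1 + 1) p.2 = (∑' p : ℕ × ℤ, h p.1 p.2) - ∑' k : ℤ, h 0 k := by
  have h1 : Summable (fun p : ℕ × ℤ => h (p.1 + 1) p.2) :=
    (hs.comp_injective shj_inj).congr fun p => by simp
  refine ⟨h1, ?_⟩
  rw [hs.tsum_prod, h1.tsum_prod, hs.prod.tsum_eq_zero_add]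
  simp

theorem FF_summable (a b : ℝ) {xm xz xp gm gz gp : ℤ → ℤ → ℝ} (hxm : Sq xm) (hxz : Sq xz)
    (hxp : Sq xp) (hgm : Sq gm) (hgz : Sq gz) (hgp : Sq gp) :
    Summable (fun p : ℕ × ℤ => FF a b (xm p.1 p.2) (xz p.1 p.2) (xp p.1 p.2)
      (gm p.1 p.2) (gz p.1 p.2) (gp p.1 p.2)) := by
  have l : Sq (fun j k => xp j k - 2 * xz j k + xm j k) := (hxp.sub (hxz.smul 2)).add hxm
  have ll := l.mul l
  unfold FF
  iterate 15 refine Summable.add ?_ (Summable.mul_left _ (Sq.mul (by assumption) (by assumption)))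
  exact Summable.mul_left _ ll

theorem GG_summable (a b : ℝ) {xm xz fm fz gm gz : ℤ → ℤ → ℝ} (hxm : Sq xm) (hxz : Sq xz)
    (hfm : Sq fm) (hfz : Sq fz) (hgm : Sq gm) (hgz : Sq gz) :
    Summable (fun p : ℕ × ℤ => GG a b (xm p.1 p.2) (xz p.1 p.2) (fm p.1 p.2)
      (fz p.1 p.2) (gm p.1 p.2) (gz p.1 p.2)) := by
  unfold GG
  iterate 40 refine Summable.add ?_ (Summable.mul_left _ (Sq.mul (by assumption) (by assumption)))
  exact Summable.mul_left _ (Sq.mul (by assumption) (by assumption))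

theorem Fd_summable (a b : ℝ) {u : ℤ → ℤ → ℝ} (hu : memH u) :
    Summable (fun p : ℕ × ℤ => Fd a b u p.1 p.2) := by
  have xz : Sq u := hu.2
  have gz : Sq (D1m u) := xz.sub (xz.shjm hu.1)
  unfold Fd
  have h := FF_summable a b xz.shkm xz (xz.shk 1) gz.shkm gz (gz.shk 1)
  exact h

theorem Gd_summable (a b : ℝ) {u : ℤ → ℤ → ℝ} (hu : memH u) :
    Summable (fun p : ℕ × ℤ => Gd a b u p.1 p.2) := by
  have xz : Sq u := hu.2
  have gz : Sq (D1m u) := xz.sub (xz.shjm hu.1)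
  have fz : Sq (D1p u) := xz.shj.sub xz
  unfold Gd
  have h := GG_summable a b xz.shkm xz fz.shkm fz gz.shkm gz
  exact h

/-- Proposition 2: bound on `4‖w‖²` in the half-space, with a boundary gain. -/
theorem halfspace_prop2 (α β : ℝ) (u : ℤ → ℤ → ℝ) (hu : memH u) :
    4 * sqH (wop α β u) + β ^ 2 * ((α ^ 2 + β ^ 2) / 2) * ∑' k : ℤ, (L2 u 0 k) ^ 2 ≤
      2 * (α ^ 2 + β ^ 2) *
        (α ^ 2 * sqH (L1 u) + β ^ 2 * sqH (L2 u)
          + (α ^ 2 + β ^ 2) * sqH (D1p (D2p u))) := by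
  have xz : Sq u := hu.2
  have gz : Sq (D1m u) := xz.sub (xz.shjm hu.1)
  have fz : Sq (D1p u) := xz.shj.sub xz
  have l1 : Sq (L1 u) := by
    refine Summable.congr (fz.sub gz) fun p => ?_
    simp [L1, D1p, D1m]
  have L2Sq : ∀ {v : ℤ → ℤ → ℝ}, Sq v → Sq (L2 v) := by
    intro v hv
    have h : Sq (D2m v) := hv.sub hv.shkm
    exact (h.shk 1).sub h
  have D20Sq : ∀ {v : ℤ → ℤ → ℝ}, Sq v → Sq (D20 v) := by
    intro v hv
    have h : Sq (D2m v) := hv.sub hv.shkm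
    have h' : Sq (D2p v) := (hv.shk 1).sub hv
    refine Summable.congr ((h'.add h).smul (1/2)) fun p => ?_
    simp only [D20]; ring
  have l2 : Sq (L2 u) := L2Sq xz
  have d : Sq (D1p (D2p u)) := by
    have h : Sq (D2p u) := (xz.shk 1).sub xz
    exact h.shj.sub h
  have w : Sq (wop α β u) := by
    have c1 := D20Sq (fz.add gz)
    have c2 := L2Sq l1
    refine Summable.congr ((((l1.smul (-(α^2/2))).sub (l2.smul (β^2/2))).sub
      (c1.smul (α*β/2))).add (c2.smul ((α^2+β^2)/8))) fun p => ?_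
    simp only [wop, L1, L2, D1p, D1m, D2p, D2m, D10, D20, add_sub_cancel_right, sub_add_cancel]
    ring
  have sF := Fd_summable α β hu
  have sG := Gd_summable α β hu
  obtain ⟨sF', tF⟩ := tele_j sF
  have tG := tele_k (h := Gd α β u)
  have sG' : Summable (fun p : ℕ × ℤ => Gd α β u p.1 (p.2 + 1)) :=
    (sG.comp_injective
      ((Equiv.refl ℕ).prodCongr (Equiv.addRight 1 : ℤ ≃ ℤ)).injective).congr fun p => by simp
  have hF0 : ∑' k : ℤ, Fd α β u 0 k = (-(β^2/2)) * ∑' k : ℤ, (L2 u 0 k) ^ 2 := by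
    rw [← tsum_mul_left]
    refine tsum_congr fun k => ?_
    have e : ∀ k, D1m u 0 k = 0 := fun k => by simp [D1m, hu.1]
    simp only [Fd, FF, e, L2, D2p, D2m, add_sub_cancel_right]
    ring
  have hL := (w.hasSum.mul_left 4).add
    (((sF'.hasSum.sub sF.hasSum).add (sG'.hasSum.sub sG.hasSum)).mul_left (α^2+β^2))
  have hR := (((l1.hasSum.mul_left (α^2)).add (l2.hasSum.mul_left (β^2))).add
    (d.hasSum.mul_left (α^2+β^2))).mul_left (2*(α^2+β^2))
  have := hasSum_le (fun p : ℕ × ℤ => pt_key α β u p.1 p.2) hL hR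
  rw [tF, tG, hF0] at this
  unfold sqH
  linarith
end
end

section
/- (Stability of the Lax-Wendroff scheme with Neumann extrapolation in a half-space.) Let a < 0, b ∈ ℝ, λ > 0, μ > 0 satisfy the CFL condition (λa)² + (μb)² ≤ 1/2, and set α := λa, β := μb. Let u ∈ ℋ, define on the interior indices 𝓘: v := −α D₁,₀ u − β D₂,₀ u and w := −(α²/2) Δ₁ u − (β²/2) Δ₂ u − αβ D₁,₀ D₂,₀ u + ((α²+β²)/8) Δ₁ Δ₂ u, and let u' ∈ ℋ be such that u'_{j,k} = u_{j,k} − w_{j,k} + v_{j,k} for all (j,k) ∈ 𝓘 (one step of the scheme with the extrapolation boundary condition). Then ‖u'‖²_{ℓ²(𝓘)} − ‖u‖²_{ℓ²(𝓘)} + (λ|a|/2)·∑_{k∈ℤ}(u_{0,k})² + (μb)²·((λa)²+(μb)²)/16 · ∑_{k∈ℤ}((Δ₂ u)_{0,k})² ≤ 0. -/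
noncomputable section

def FX (α β xmm xmo xmp xom xoo xop : ℝ) : ℝ :=
  ((5/8)*α*α + (3/16)*β*β + (-3/4)*α*α*α + (-1/4)*α*β*β + (1/16)*α*β) * (xoo * xoo)
    + ((-9/8)*α*α + (-25/16)*β*β + (-3/4)*α*α*α + (-1/4)*α*β*β + (1/16)*α*β) * (xmo * xmo)
    + ((1/4)*α*α + (3/8)*β*β + (-1)*α + (3/2)*α*α*α + (3/2)*α*β*β + (-1/8)*α*β) * (xmo * xoo)
    + ((-3/32)*α*α + (5/16)*α*β + (-7/32)*β*β + (-1/4)*α*α*β + (1/8)*α*α*α + (1/8)*α*β*β) * (xoo * xop)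
    + ((9/32)*α*α + (3/16)*α*β + (1/32)*β*β + (-1)*β + (5/4)*α*α*β + (1/8)*α*α*α + (1/8)*α*β*β + (3/2)*β*β*β) * (xmo * xmp)
    + ((1/16)*α*α + (1/16)*β*β + (-3/4)*α*β*β + (-1/4)*α*α*α + (-3/4)*α*α*β + (-1/4)*β*β*β + (1/8)*α*β) * (xmp * xoo)
    + ((-5/32)*α*α + (-5/16)*α*β + (-5/32)*β*β + (1/4)*α*α*β + (1/8)*α*α*α + (1/8)*α*β*β) * (xom * xoo)
    + ((-1/32)*α*α + (-3/16)*α*β + (3/32)*β*β + (1)*β + (-5/4)*α*α*β + (1/8)*α*α*α + (1/8)*α*β*β + (-3/2)*β*β*β) * (xmm * xmo)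
    + ((3/16)*α*α + (1/16)*β*β + (-3/4)*α*β*β + (-1/4)*α*α*α + (3/4)*α*α*β + (1/4)*β*β*β + (-1/4)*α*β) * (xmm * xoo)
    + ((-3/16)*α*α + (3/8)*α*β + (-3/16)*β*β) * (xmo * xop)
    + ((-1/16)*α*α + (-1/4)*α*β + (-3/16)*β*β) * (xmo * xom)
    + ((3/32)*α*α + (-3/16)*α*β + (3/32)*β*β) * (xop * xop)
    + ((9/32)*α*α + (-1/8)*α*β + (23/32)*β*β + (-3/4)*β*β*β + (-1/4)*α*α*β) * (xmp * xmp)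
    + ((-7/32)*α*α + (5/16)*α*β + (-3/32)*β*β + (-1/4)*α*β*β + (1/8)*α*α*β + (1/8)*β*β*β) * (xmp * xop)
    + ((1/32)*α*α + (1/32)*β*β + (1/4)*α*β*β + (-1/8)*α*α*β + (-1/8)*β*β*β + (-1/16)*α*β) * (xmm * xop)
    + ((1/32)*α*α + (1/32)*β*β + (1/4)*α*β*β + (1/8)*α*α*β + (1/8)*β*β*β + (1/16)*α*β) * (xmp * xom)
    + ((1/16)*α*α + (1/8)*α*β + (1/16)*β*β) * (xom * xom)
    + ((1/8)*α*α + (1/16)*α*β + (11/16)*β*β + (3/4)*β*β*β + (1/4)*α*α*β) * (xmm * xmm)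
    + ((-3/32)*α*α + (-3/16)*α*β + (-3/32)*β*β + (-1/4)*α*β*β + (-1/8)*α*α*β + (-1/8)*β*β*β) * (xmm * xom)
    + ((-1/32)*α*α + (1/32)*β*β) * (xom * xop)
    + ((-1/32)*α*α + (1/32)*β*β) * (xmm * xmp)

def FY (α β xmm xom xpm xmo xoo xpo : ℝ) : ℝ :=
  ((-5/32)*α*α + (-23/32)*β*β + (-3/4)*β*β*β + (-1/4)*α*α*β) * (xmm * xmm)
    + ((1/8)*α*α + (1/4)*β*β + (1/4)*α*α*β + (1/4)*β*β*β) * (xmm * xom)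
    + ((3/16)*α*α + (-1/16)*β*β + (-1)*β + (1)*α*α*β + (3/2)*β*β*β) * (xmm * xmo)
    + ((-1/8)*α*α + (-1/8)*α*β + (-3/4)*α*β*β + (-1/4)*α*α*α + (-3/4)*α*α*β + (-1/4)*β*β*β) * (xmo * xom)
    + ((1/32)*α*α + (1/32)*β*β + (1/4)*α*α*β + (1/8)*α*α*α + (1/8)*α*β*β + (1/16)*α*β) * (xmo * xpm)
    + ((-1/8)*α*α + (1/8)*α*β + (3/4)*α*β*β + (1/4)*α*α*α + (-3/4)*α*α*β + (-1/4)*β*β*β) * (xmm * xoo)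
    + ((1/32)*α*α + (1/32)*β*β + (1/4)*α*α*β + (-1/8)*α*α*α + (-1/8)*α*β*β + (-1/16)*α*β) * (xmm * xpo)
    + ((11/32)*α*α + (25/32)*β*β + (-3/4)*β*β*β + (-1/4)*α*α*β) * (xmo * xmo)
    + ((-3/8)*α*α + (-1/4)*β*β + (1/4)*α*α*β + (1/4)*β*β*β) * (xmo * xoo)
    + ((1/32)*α*α + (-1/32)*β*β) * (xmo * xpo)
    + ((1/32)*α*α + (-1/32)*β*β) * (xmm * xpm)

def FH (α β xom xoo : ℝ) : ℝ :=
  ((3/32)*α*α + (19/32)*β*β + (-1/2)*α*β*β + (5/8)*β*β*β + (1/8)*α*α*β) * (xom * xom)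
    + ((-1/16)*α*α + (-1)*α*β + (1/16)*β*β + (-1/4)*α*α*β + (1/2)*α*β*β + (1)*β + (-5/4)*β*β*β) * (xom * xoo)
    + ((-5/32)*α*α + (-21/32)*β*β + (5/8)*β*β*β + (1/8)*α*α*β) * (xoo * xoo)

/-- `sF` and `sG` split the selfadjoint part as `w = 2 (α F + β G)`. -/
def sF (α β xmm xmo xmp xom xoo xop xpm xpo xpp : ℝ) : ℝ := (-3/8)*xpo*α + (3/4)*xoo*α + (-3/8)*xmo*α + (1/16)*xpp*α + (-1/8)*xop*α + (1/16)*xmp*α + (1/16)*xpm*α + (-1/8)*xom*α + (1/16)*xmm*α + (-1/16)*xpp*β + (1/16)*xmp*β + (1/16)*xpm*β + (-1/16)*xmm*β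
def sG (α β xmm xmo xmp xom xoo xop xpm xpo xpp : ℝ) : ℝ := (-3/8)*xop*β + (3/4)*xoo*β + (-3/8)*xom*β + (1/16)*xpp*β + (1/16)*xmp*β + (-1/8)*xpo*β + (-1/8)*xmo*β + (1/16)*xpm*β + (1/16)*xmm*β + (-1/16)*xpp*α + (1/16)*xmp*α + (1/16)*xpm*α + (-1/16)*xmm*α

theorem local_ineq (α β : ℝ) (h : α ^ 2 + β ^ 2 ≤ 1 / 2) (xmm xmo xmp xom xoo xop xpm xpo xpp w v : ℝ)
    (hw : w = (-3/4)*xpo*α*α + (3/2)*xoo*α*α + (-3/4)*xmo*α*α + (-3/4)*xop*β*β + (3/2)*xoo*β*β + (-3/4)*xom*β*β + (-1/4)*xpp*α*β + (1/4)*xmp*α*β + (1/4)*xpm*α*β + (-1/4)*xmm*α*β + (1/8)*xpp*α*α + (-1/4)*xop*α*α + (1/8)*xmp*α*α + (1/8)*xpm*α*α + (-1/4)*xom*α*α + (1/8)*xmm*α*α + (1/8)*xpp*β*β + (1/8)*xmp*β*β + (-1/4)*xpo*β*β + (-1/4)*xmo*β*β + (1/8)*xpm*β*β + (1/8)*xm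m*β*β)
    (hv : v = (-1/2)*xpo*α + (1/2)*xmo*α + (-1/2)*xop*β + (1/2)*xom*β) :
    (xoo - w + v) ^ 2 - xoo ^ 2 ≤
      FX α β xom xoo xop xpm xpo xpp - FX α β xmm xmo xmp xom xoo xop +
      (FY α β xmo xoo xpo xmp xop xpp - FY α β xmm xom xpm xmo xoo xpo) := by
  have key : FX α β xom xoo xop xpm xpo xpp - FX α β xmm xmo xmp xom xoo xop +
      (FY α β xmo xoo xpo xmp xop xpp - FY α β xmm xom xpm xmo xoo xpo) =
      (xoo - w + v) ^ 2 - xoo ^ 2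
      + (2 - 4 * (α ^ 2 + β ^ 2)) * ((sF α β xmm xmo xmp xom xoo xop xpm xpo xpp) ^ 2 + (sG α β xmm xmo xmp xom xoo xop xpm xpo xpp) ^ 2)
      + 4 * (β * sF α β xmm xmo xmp xom xoo xop xpm xpo xpp - α * sG α β xmm xmo xmp xom xoo xop xpm xpo xpp) ^ 2
      + 1 / 2 * ((1/4)*xpo*α + (-1/2)*xoo*α + (1/4)*xpp*α + (-1/2)*xop*α + (-1/4)*xpp*β + (1/4)*xpo*β + (1/4)*xmo*α + (1/4)*xmp*α + (1/4)*xmp*β + (-1/4)*xmo*β) ^ 2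
      + 1 / 2 * ((1/4)*xpp*α + (-1/4)*xop*α + (-1/4)*xop*β + (1/2)*xoo*β + (-1/4)*xpp*β + (1/2)*xpo*β + (-1/4)*xpm*α + (1/4)*xom*α + (-1/4)*xom*β + (-1/4)*xpm*β) ^ 2
      + ((-1/8)*xpp*α + (1/8)*xmp*α + (1/4)*xpo*α + (-1/4)*xmo*α + (1/8)*xpp*β + (-1/4)*xop*β + (1/8)*xmp*β + (-1/8)*xpm*α + (1/8)*xmm*α + (-1/8)*xpm*β + (1/4)*xom*β + (-1/8)*xmm*β) ^ 2 := by
    subst hw hv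
    unfold FX FY sF sG
    ring
  rw [key]
  have h2 : 0 ≤ 2 - 4 * (α ^ 2 + β ^ 2) := by linarith
  have h3 := mul_nonneg h2 (add_nonneg (sq_nonneg (sF α β xmm xmo xmp xom xoo xop xpm xpo xpp)) (sq_nonneg (sG α β xmm xmo xmp xom xoo xop xpm xpo xpp)))
  have h4 := sq_nonneg (β * sF α β xmm xmo xmp xom xoo xop xpm xpo xpp - α * sG α β xmm xmo xmp xom xoo xop xpm xpo xpp)
  have h5 := sq_nonneg ((1/4)*xpo*α + (-1/2)*xoo*α + (1/4)*xpp*α + (-1/2)*xop*α + (-1/4)*xpp*β + (1/4)*xpo*β + (1/4)*xmo*α + (1/4)*xmp*α + (1/4)*xmp*β + (-1/4)*xmo*β)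
  have h6 := sq_nonneg ((1/4)*xpp*α + (-1/4)*xop*α + (-1/4)*xop*β + (1/2)*xoo*β + (-1/4)*xpp*β + (1/2)*xpo*β + (-1/4)*xpm*α + (1/4)*xom*α + (-1/4)*xom*β + (-1/4)*xpm*β)
  have h7 := sq_nonneg ((-1/8)*xpp*α + (1/8)*xmp*α + (1/4)*xpo*α + (-1/4)*xmo*α + (1/8)*xpp*β + (-1/4)*xop*β + (1/8)*xmp*β + (-1/8)*xpm*α + (1/8)*xmm*α + (-1/8)*xpm*β + (1/4)*xom*β + (-1/8)*xmm*β)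
  linarith

theorem bdry_id (α β xom xoo xop : ℝ) :
    -FX α β xom xoo xop xom xoo xop =
      α * xoo ^ 2 - α * β ^ 2 * ((xop - 2 * xoo + xom) ^ 2 / 4 - (xop - xoo) ^ 2 / 2)
      - β ^ 2 * (xop - 2 * xoo + xom) ^ 2 / 16 + (FH α β xoo xop - FH α β xom xoo) := by
  unfold FX FH
  ring

def Fx (α β : ℝ) (u : ℤ → ℤ → ℝ) (j k : ℤ) : ℝ := FX α β (u (j-1) (k-1)) (u (j-1) k) (u (j-1) (k+1)) (u j (k-1)) (u j k) (u j (k+1))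
def Fy (α β : ℝ) (u : ℤ → ℤ → ℝ) (j k : ℤ) : ℝ := FY α β (u (j-1) (k-1)) (u j (k-1)) (u (j+1) (k-1)) (u (j-1) k) (u j k) (u (j+1) k)

/-- Summability over the interior indices. -/
def SH (f : ℤ → ℤ → ℝ) : Prop := Summable (fun p : ℕ × ℤ => f (p.1 : ℤ) p.2)

theorem SH.add {f g : ℤ → ℤ → ℝ} (hf : SH f) (hg : SH g) : SH (fun j k => f j k + g j k) :=
  Summable.add hf hg

theorem SH.cmul {f : ℤ → ℤ → ℝ} (c : ℝ) (hf : SH f) : SH (fun j k => c * f j k) :=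
  Summable.mul_left c hf

theorem summable_mul_of_sq {ι : Type} {f g : ι → ℝ} (hf : Summable (fun i => f i ^ 2))
    (hg : Summable (fun i => g i ^ 2)) : Summable (fun i => f i * g i) := by
  refine Summable.of_norm_bounded (hf.add hg) ?_
  intro i
  rw [Real.norm_eq_abs, abs_le]
  constructor <;> nlinarith [sq_nonneg (f i + g i), sq_nonneg (f i - g i), sq_nonneg (f i), sq_nonneg (g i)]

theorem SH.prod {f g : ℤ → ℤ → ℝ} (hf : SH (fun j k => f j k ^ 2)) (hg : SH (fun j k => g j k ^ 2)) :
    SH (fun j k => f j k * g j k) :=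
  summable_mul_of_sq hf hg

theorem SH.shift2 {f : ℤ → ℤ → ℝ} (hf : SH f) (c : ℤ) : SH (fun j k => f j (k + c)) := by
  have := (Equiv.summable_iff ((Equiv.refl ℕ).prodCongr (Equiv.addRight c))).2 hf
  exact this

theorem SH.shift1 {f : ℤ → ℤ → ℝ} (hf : SH f) : SH (fun j k => f (j + 1) k) := by
  have hi : Function.Injective (fun p : ℕ × ℤ => (p.1 + 1, p.2)) := by
    rintro ⟨a, b⟩ ⟨c, d⟩ h
    simpa using h
  have := hf.comp_injective hi
  refine this.congr ?_
  intro p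
  simp

theorem SH.row {f : ℤ → ℤ → ℝ} (hf : SH f) (n : ℕ) : Summable (fun k => f (n : ℤ) k) :=
  hf.prod_factor n

theorem SH.shiftm {f : ℤ → ℤ → ℝ} (hf : SH f) (hb : ∀ k, f (-1) k = f 0 k) :
    SH (fun j k => f (j - 1) k) := by
  have hi : Function.Injective (fun p : ℕ × ℤ => (p.1 + 1, p.2)) := by
    rintro ⟨a, b⟩ ⟨c, d⟩ h
    simpa using h
  -- split as row zero plus the shifted part
  have h1 : Summable (Function.extend (fun p : ℕ × ℤ => (p.1 + 1, p.2))
      (fun p : ℕ × ℤ => f (p.1 : ℤ) p.2) 0) := (Function.Injective.summable_iff hi (by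
        intro x hx
        exact Function.extend_apply' _ _ _ (by simpa using hx))).1 (by
          rw [Function.extend_comp hi]; exact hf)
  have hi0 : Function.Injective (fun k : ℤ => ((0 : ℕ), k)) := by
    intro a b h
    simpa using h
  have h2 : Summable (Function.extend (fun k : ℤ => ((0 : ℕ), k))
      (fun k : ℤ => f 0 k) 0) := (Function.Injective.summable_iff hi0 (by
        intro x hx
        exact Function.extend_apply' _ _ _ (by simpa using hx))).1 (by
          rw [Function.extend_comp hi0]; exact hf.row 0)
  refine (h1.add h2).congr ?_
  rintro ⟨j, k⟩
  rcases j with _ | j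
  · have e1 : Function.extend (fun p : ℕ × ℤ => (p.1 + 1, p.2))
      (fun p : ℕ × ℤ => f (p.1 : ℤ) p.2) 0 (0, k) = 0 :=
        Function.extend_apply' _ _ _ (by simp)
    have e2 := hi0.extend_apply (fun k : ℤ => f 0 k) 0 k
    rw [e1, e2]
    simp [hb]
  · have e1 := hi.extend_apply (fun p : ℕ × ℤ => f (p.1 : ℤ) p.2) 0 (j, k)
    have e2 : Function.extend (fun k : ℤ => ((0 : ℕ), k))
      (fun k : ℤ => f 0 k) 0 (j + 1, k) = 0 :=
        Function.extend_apply' _ _ _ (by simp)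
    rw [e1, e2]
    simp

theorem tele (f g : ℤ → ℤ → ℝ) (hf : SH f) (hg : SH g) :
    SH (fun j k => f (j + 1) k - f j k + (g j (k + 1) - g j k)) ∧
    ∑' p : ℕ × ℤ, (f ((p.1 : ℤ) + 1) p.2 - f p.1 p.2 + (g p.1 (p.2 + 1) - g p.1 p.2))
      = - ∑' k : ℤ, f 0 k := by
  have hf1 : Summable (fun p : ℕ × ℤ => f ((p.1 : ℤ) + 1) p.2) := hf.shift1
  have hg1 : Summable (fun p : ℕ × ℤ => g (p.1 : ℤ) (p.2 + 1)) := hg.shift2 1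
  unfold SH at hf hg
  refine ⟨(Summable.sub hf1 hf).add (Summable.sub hg1 hg), ?_⟩
  rw [Summable.tsum_add (Summable.sub hf1 hf) (Summable.sub hg1 hg),
    Summable.tsum_sub hf1 hf, Summable.tsum_sub hg1 hg]
  have e1 : ∑' p : ℕ × ℤ, g p.1 (p.2 + 1) = ∑' p : ℕ × ℤ, g p.1 p.2 :=
    Equiv.tsum_eq ((Equiv.refl ℕ).prodCongr (Equiv.addRight (1 : ℤ)))
      (fun p : ℕ × ℤ => g (p.1 : ℤ) p.2)
  have e2 : ∑' p : ℕ × ℤ, f p.1 p.2 = ∑' k : ℤ, f 0 k + ∑' p : ℕ × ℤ, f ((p.1 : ℤ) + 1) p.2 := by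
    rw [Summable.tsum_prod hf, Summable.tsum_prod hf1, Summable.tsum_eq_zero_add hf.prod]
    simp
  rw [e1, e2]
  ring

theorem tsum_shift (f : ℤ → ℝ) (c : ℤ) : ∑' k : ℤ, f (k + c) = ∑' k : ℤ, f k :=
  Equiv.tsum_eq (Equiv.addRight c) f

theorem summable_shift {f : ℤ → ℝ} (hf : Summable f) (c : ℤ) : Summable (fun k => f (k + c)) :=
  (Equiv.summable_iff (Equiv.addRight c)).2 hf

theorem Fx_summable (α β : ℝ) (u : ℤ → ℤ → ℝ) (hu : memH u) : SH (Fx α β u) := by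
  have h00 : SH (fun j k => u j k ^ 2) := hu.2
  have hm0 : SH (fun j k => u (j - 1) k ^ 2) := h00.shiftm (by intro k; rw [hu.1])
  have h0p : SH (fun j k => u j (k + 1) ^ 2) := h00.shift2 1
  have h0m : SH (fun j k => u j (k - 1) ^ 2) := h00.shift2 (-1)
  have hmp : SH (fun j k => u (j - 1) (k + 1) ^ 2) := hm0.shift2 1
  have hmm : SH (fun j k => u (j - 1) (k - 1) ^ 2) := hm0.shift2 (-1)
  unfold Fx FX
  repeat' first
    | with_reducible refine SH.add ?_ ?_
    | with_reducible exact SH.cmul _ (SH.prod (by assumption) (by assumption))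

theorem Fy_summable (α β : ℝ) (u : ℤ → ℤ → ℝ) (hu : memH u) : SH (Fy α β u) := by
  have h00 : SH (fun j k => u j k ^ 2) := hu.2
  have hm0 : SH (fun j k => u (j - 1) k ^ 2) := h00.shiftm (by intro k; rw [hu.1])
  have hp0 : SH (fun j k => u (j + 1) k ^ 2) := h00.shift1
  have h0m : SH (fun j k => u j (k - 1) ^ 2) := h00.shift2 (-1)
  have hmm : SH (fun j k => u (j - 1) (k - 1) ^ 2) := hm0.shift2 (-1)
  have hpm : SH (fun j k => u (j + 1) (k - 1) ^ 2) := hp0.shift2 (-1)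
  unfold Fy FY
  repeat' first
    | with_reducible refine SH.add ?_ ?_
    | with_reducible exact SH.cmul _ (SH.prod (by assumption) (by assumption))

theorem interior_bound (α β : ℝ) (h : α ^ 2 + β ^ 2 ≤ 1 / 2) (u u' : ℤ → ℤ → ℝ)
    (hu : memH u) (hu' : memH u')
    (hstep : ∀ j : ℤ, 0 ≤ j → ∀ k : ℤ, u' j k = u j k - wop α β u j k + vop α β u j k) :
    sqH u' - sqH u ≤ ∑' k : ℤ, - Fx α β u 0 k := by
  obtain ⟨hs, ht⟩ := tele _ _ (Fx_summable α β u hu) (Fy_summable α β u hu)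
  rw [tsum_neg, ← ht]
  unfold sqH
  rw [← Summable.tsum_sub hu'.2 hu.2]
  refine Summable.tsum_le_tsum ?_ (hu'.2.sub hu.2) hs
  rintro ⟨n, k⟩
  generalize hj : (n : ℤ) = j at *
  have hj0 : 0 ≤ j := by omega
  simp only [hstep j hj0 k]
  have := local_ineq α β h (u (j-1) (k-1)) (u (j-1) k) (u (j-1) (k+1)) (u j (k-1)) (u j k)
    (u j (k+1)) (u (j+1) (k-1)) (u (j+1) k) (u (j+1) (k+1)) (wop α β u j k) (vop α β u j k)
    (by simp only [wop, L1, L2, D10, D20, D1p, D1m, D2p, D2m, add_sub_cancel_right]; ring)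
    (by simp only [vop, D10, D20, D1p, D1m, D2p, D2m]; ring)
  simpa only [Fx, Fy, add_sub_cancel_right] using this

theorem boundary_bound (α β : ℝ) (hα : α < 0) (h : α ^ 2 + β ^ 2 ≤ 1 / 2) (u : ℤ → ℤ → ℝ)
    (hu : memH u) :
    (∑' k : ℤ, - Fx α β u 0 k) + (-α) / 2 * ∑' k : ℤ, (u 0 k) ^ 2
      + β ^ 2 * (α ^ 2 + β ^ 2) / 16 * ∑' k : ℤ, (L2 u 0 k) ^ 2 ≤ 0 := by
  set x : ℤ → ℝ := fun k => u 0 k with hx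
  have hs : Summable (fun k => x k ^ 2) := by
    have h00 : SH (fun j k => u j k ^ 2) := hu.2
    simpa using h00.row 0
  have hsp : Summable (fun k => x (k + 1) ^ 2) := summable_shift hs 1
  have hsm : Summable (fun k => x (k - 1) ^ 2) := summable_shift hs (-1)
  have ep : ∑' k, x (k + 1) ^ 2 = ∑' k, x k ^ 2 := tsum_shift (fun k => x k ^ 2) 1
  have em : ∑' k, x (k - 1) ^ 2 = ∑' k, x k ^ 2 := tsum_shift (fun k => x k ^ 2) (-1)
  have hpo := summable_mul_of_sq hsp hs
  have hpm := summable_mul_of_sq hsp hsm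
  have hmo := summable_mul_of_sq hsm hs
  have hL : Summable (fun k => (x (k + 1) - 2 * x k + x (k - 1)) ^ 2) := by
    refine (((hsp.add (hs.mul_left 4)).add hsm).add
      (((hpo.mul_left (-4)).add (hpm.mul_left 2)).add (hmo.mul_left (-4)))).congr ?_
    intro k; ring
  have hD : Summable (fun k => (x (k + 1) - x k) ^ 2) := by
    refine ((hsp.add hs).add (hpo.mul_left (-2))).congr ?_
    intro k; ring
  have hDm : Summable (fun k => (x k - x (k - 1)) ^ 2) := by
    refine (summable_shift hD (-1)).congr ?_
    intro k
    rw [← sub_eq_add_neg, sub_add_cancel]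
  have eDm : ∑' k, (x k - x (k - 1)) ^ 2 = ∑' k, (x (k + 1) - x k) ^ 2 := by
    rw [← tsum_shift (fun k => (x (k + 1) - x k) ^ 2) (-1)]
    refine tsum_congr ?_
    intro k
    rw [← sub_eq_add_neg, sub_add_cancel]
  have hH : Summable (fun k => FH α β (x (k - 1)) (x k)) := by
    unfold FH
    refine (Summable.add (Summable.add ?_ ?_) ?_)
    · simp only [← pow_two (x _)]
      exact hsm.mul_left _
    · exact hmo.mul_left _
    · simp only [← pow_two (x _)]
      exact hs.mul_left _
  have hH1 : Summable (fun k => FH α β (x k) (x (k + 1))) := by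
    refine (summable_shift hH 1).congr ?_
    intro k
    rw [add_sub_cancel_right]
  have eH : ∑' k, FH α β (x k) (x (k + 1)) = ∑' k, FH α β (x (k - 1)) (x k) := by
    rw [← tsum_shift (fun k => FH α β (x (k - 1)) (x k)) 1]
    refine tsum_congr ?_
    intro k
    rw [add_sub_cancel_right]
  have eB : ∑' k : ℤ, - Fx α β u 0 k = α * ∑' k, x k ^ 2
      + (-(α * β ^ 2) / 4 - β ^ 2 / 16) * ∑' k, (x (k + 1) - 2 * x k + x (k - 1)) ^ 2
      + (α * β ^ 2 / 2) * ∑' k, (x (k + 1) - x k) ^ 2 := by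
    have e : ∀ k : ℤ, - Fx α β u 0 k = ((α * x k ^ 2
      + (-(α * β ^ 2) / 4 - β ^ 2 / 16) * (x (k + 1) - 2 * x k + x (k - 1)) ^ 2)
      + (α * β ^ 2 / 2) * (x (k + 1) - x k) ^ 2) +
        (FH α β (x k) (x (k + 1)) - FH α β (x (k - 1)) (x k)) := by
      intro k
      simp only [Fx, zero_sub, hu.1]
      rw [bdry_id]
      simp only [hx]
      ring
    rw [tsum_congr e, Summable.tsum_add (((hs.mul_left _).add (hL.mul_left _)).add (hD.mul_left _))
      (hH1.sub hH), Summable.tsum_add ((hs.mul_left _).add (hL.mul_left _)) (hD.mul_left _),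
      Summable.tsum_add (hs.mul_left _) (hL.mul_left _), Summable.tsum_sub hH1 hH, eH,
      tsum_mul_left, tsum_mul_left, tsum_mul_left]
    ring
  have eL : ∑' k : ℤ, (L2 u 0 k) ^ 2 = ∑' k, (x (k + 1) - 2 * x k + x (k - 1)) ^ 2 := by
    refine tsum_congr ?_
    intro k
    simp only [L2, D2p, D2m, hx, add_sub_cancel_right]
    ring
  have b1 : ∑' k, (x (k + 1) - 2 * x k + x (k - 1)) ^ 2 ≤ 4 * ∑' k, (x (k + 1) - x k) ^ 2 := by
    have : ∑' k, (x (k + 1) - 2 * x k + x (k - 1)) ^ 2 ≤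
        ∑' k, (2 * (x (k + 1) - x k) ^ 2 + 2 * (x k - x (k - 1)) ^ 2) := by
      refine Summable.tsum_le_tsum ?_ hL ((hD.mul_left 2).add (hDm.mul_left 2))
      intro k
      nlinarith [sq_nonneg (x (k + 1) - x (k - 1))]
    rw [Summable.tsum_add (hD.mul_left 2) (hDm.mul_left 2), tsum_mul_left, tsum_mul_left, eDm] at this
    linarith
  have b2 : ∑' k, (x (k + 1) - x k) ^ 2 ≤ 4 * ∑' k, x k ^ 2 := by
    have : ∑' k, (x (k + 1) - x k) ^ 2 ≤ ∑' k, (2 * x (k + 1) ^ 2 + 2 * x k ^ 2) := by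
      refine Summable.tsum_le_tsum ?_ hD ((hsp.mul_left 2).add (hs.mul_left 2))
      intro k
      nlinarith [sq_nonneg (x (k + 1) + x k)]
    rw [Summable.tsum_add (hsp.mul_left 2) (hs.mul_left 2), tsum_mul_left, tsum_mul_left, ep] at this
    linarith
  have b3 : 0 ≤ ∑' k, (x (k + 1) - 2 * x k + x (k - 1)) ^ 2 := tsum_nonneg (fun k => sq_nonneg _)
  rw [eB, eL]
  change α * ∑' k, x k ^ 2
      + (-(α * β ^ 2) / 4 - β ^ 2 / 16) * ∑' k, (x (k + 1) - 2 * x k + x (k - 1)) ^ 2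
      + (α * β ^ 2 / 2) * ∑' k, (x (k + 1) - x k) ^ 2 + (-α) / 2 * ∑' k, x k ^ 2
      + β ^ 2 * (α ^ 2 + β ^ 2) / 16 * ∑' k, (x (k + 1) - 2 * x k + x (k - 1)) ^ 2 ≤ 0
  generalize (∑' k, (x (k + 1) - 2 * x k + x (k - 1)) ^ 2) = N at *
  generalize (∑' k, (x (k + 1) - x k) ^ 2) = D at *
  generalize (∑' k, x k ^ 2) = M at *
  obtain ⟨a, rfl⟩ : ∃ a, α = -a := ⟨-α, by ring⟩
  have ha : 0 < a := by linarith
  have hb : 0 ≤ β ^ 2 := sq_nonneg β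
  have c1 : a * β ^ 2 / 2 * (N / 4) ≤ a * β ^ 2 / 2 * D :=
    mul_le_mul_of_nonneg_left (by linarith) (by positivity)
  have c2 : β ^ 2 * N / 16 * (((-a) ^ 2 + β ^ 2)) ≤ β ^ 2 * N / 16 * (1 / 2) :=
    mul_le_mul_of_nonneg_left h (by positivity)
  have hM : N ≤ 16 * M := by linarith
  have c3 : β ^ 2 * (a / 8 - 1 / 32) * N ≤ a / 2 * M := by
    rcases le_total a (1 / 4) with h4 | h4
    · have : β ^ 2 * (a / 8 - 1 / 32) ≤ 0 := mul_nonpos_of_nonneg_of_nonpos hb (by linarith)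
      have := mul_nonpos_of_nonpos_of_nonneg this b3
      have : 0 ≤ a / 2 * M := mul_nonneg (by linarith) (by linarith)
      linarith
    · have hb2 : β ^ 2 ≤ 1 / 2 - a ^ 2 := by nlinarith
      have e1 : β ^ 2 * (a / 8 - 1 / 32) ≤ (1 / 2 - a ^ 2) * (a / 8 - 1 / 32) :=
        mul_le_mul_of_nonneg_right hb2 (by linarith)
      have e2 : (1 / 2 - a ^ 2) * (a / 8 - 1 / 32) ≤ a / 32 := by
        nlinarith [sq_nonneg (a - 1 / 2), mul_nonneg ha.le (sq_nonneg (a - 1 / 2))]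
      calc β ^ 2 * (a / 8 - 1 / 32) * N ≤ a / 32 * N := mul_le_mul_of_nonneg_right (e1.trans e2) b3
        _ ≤ a / 32 * (16 * M) := mul_le_mul_of_nonneg_left hM (by linarith)
        _ = a / 2 * M := by ring
  nlinarith [c1, c2, c3]

/-- Theorem 1: stability of the Lax-Wendroff scheme with the Neumann extrapolation
boundary condition in the half-space, with trace estimates. -/
theorem halfspace_stability (a b lam mu : ℝ) (ha : a < 0) (hlam : 0 < lam) (hmu : 0 < mu)
    (hCFL : (lam * a) ^ 2 + (mu * b) ^ 2 ≤ 1 / 2)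
    (u u' : ℤ → ℤ → ℝ) (hu : memH u) (hu' : memH u')
    (hstep : ∀ j : ℤ, 0 ≤ j → ∀ k : ℤ,
      u' j k = u j k - wop (lam * a) (mu * b) u j k + vop (lam * a) (mu * b) u j k) :
    sqH u' - sqH u + lam * |a| / 2 * ∑' k : ℤ, (u 0 k) ^ 2
      + (mu * b) ^ 2 * ((lam * a) ^ 2 + (mu * b) ^ 2) / 16 * ∑' k : ℤ, (L2 u 0 k) ^ 2 ≤ 0 := by
  have hα : lam * a < 0 := mul_neg_of_pos_of_neg hlam ha
  have h1 := interior_bound (lam * a) (mu * b) hCFL u u' hu hu' hstep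
  have h2 := boundary_bound (lam * a) (mu * b) hα hCFL u hu
  have e : lam * |a| / 2 = -(lam * a) / 2 := by rw [abs_of_neg ha]; ring
  rw [e]
  linarith
end
end

section
/- Let α, β be real numbers, let u ∈ 𝔥, and define on the interior indices 𝔦: w := −(α²/2) Δ₁ u − (β²/2) Δ₂ u − αβ D₁,₀ D₂,₀ u + ((α²+β²)/8) Δ₁ Δ₂ u. Then 4‖w‖²_{ℓ²(𝔦)} + β²·((α²+β²)/2)·∑_{k≥0} ((Δ₂ u)_{0,k})² + α²·((α²+β²)/2)·∑_{j≥0} ((Δ₁ u)_{j,0})² ≤ 2(α²+β²)·( α²‖Δ₁ u‖²_{ℓ²(𝔦)} + β²‖Δ₂ u‖²_{ℓ²(𝔦)} + (α²+β²)‖D₁₊ D₂₊ u‖²_{ℓ²(𝔦)} ). -/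
noncomputable section

theorem aux_shift1 (h : ℤ → ℤ → ℝ) (c : ℝ) (h0 : ∀ k : ℕ, h (-1) k = 0)
    (hs : HasSum (fun p : ℕ × ℕ => h (p.1 : ℤ) (p.2 : ℤ)) c) :
    HasSum (fun p : ℕ × ℕ => h ((p.1 : ℤ) - 1) (p.2 : ℤ)) c := by
  have hi : Function.Injective (fun p : ℕ × ℕ => (p.1 + 1, p.2)) := by
    rintro ⟨a, b⟩ ⟨c, d⟩ hh
    simpa using hh
  rw [← hi.hasSum_iff]
  · convert hs using 2 with p
    simp
  · rintro ⟨j, k⟩ hp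
    cases j with
    | zero => simpa using h0 k
    | succ n => exact absurd ⟨(n, k), rfl⟩ hp

theorem aux_shift2 (h : ℤ → ℤ → ℝ) (c : ℝ) (h0 : ∀ j : ℕ, h j (-1) = 0)
    (hs : HasSum (fun p : ℕ × ℕ => h (p.1 : ℤ) (p.2 : ℤ)) c) :
    HasSum (fun p : ℕ × ℕ => h (p.1 : ℤ) ((p.2 : ℤ) - 1)) c := by
  have hi : Function.Injective (fun p : ℕ × ℕ => (p.1, p.2 + 1)) := by
    rintro ⟨a, b⟩ ⟨c, d⟩ hh
    simpa using hh
  rw [← hi.hasSum_iff]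
  · convert hs using 2 with p
    simp
  · rintro ⟨j, k⟩ hp
    cases k with
    | zero => simpa using h0 j
    | succ n => exact absurd ⟨(j, n), rfl⟩ hp

theorem aux_up1 (h : ℤ → ℤ → ℝ)
    (hs : Summable (fun p : ℕ × ℕ => h (p.1 : ℤ) (p.2 : ℤ))) :
    Summable (fun p : ℕ × ℕ => h ((p.1 : ℤ) + 1) (p.2 : ℤ)) := by
  have hi : Function.Injective (fun p : ℕ × ℕ => (p.1 + 1, p.2)) := by
    rintro ⟨a, b⟩ ⟨c, d⟩ hh
    simpa using hh
  have := hs.comp_injective hi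
  simpa [Function.comp_def] using this

theorem aux_up2 (h : ℤ → ℤ → ℝ)
    (hs : Summable (fun p : ℕ × ℕ => h (p.1 : ℤ) (p.2 : ℤ))) :
    Summable (fun p : ℕ × ℕ => h (p.1 : ℤ) ((p.2 : ℤ) + 1)) := by
  have hi : Function.Injective (fun p : ℕ × ℕ => (p.1, p.2 + 1)) := by
    rintro ⟨a, b⟩ ⟨c, d⟩ hh
    simpa using hh
  have := hs.comp_injective hi
  simpa [Function.comp_def] using this

theorem aux_val {ι : Type} {f : ι → ℝ} {a b : ℝ} (h : HasSum f a) (e : a = b) :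
    HasSum f b := e ▸ h

theorem aux_sub {ι : Type} (f g : ι → ℝ) (hf : Summable (fun i => f i ^ 2))
    (hg : Summable (fun i => g i ^ 2)) : Summable (fun i => (f i - g i) ^ 2) := by
  refine Summable.of_nonneg_of_le (fun i => sq_nonneg _) (fun i => ?_)
    ((hf.mul_left 2).add (hg.mul_left 2))
  nlinarith [sq_nonneg (f i + g i)]

theorem aux_b1 (h : ℤ → ℤ → ℝ)
    (hs : Summable (fun p : ℕ × ℕ => h (p.1 : ℤ) (p.2 : ℤ))) :
    HasSum (fun p : ℕ × ℕ => if p.1 = 0 then h (p.1 : ℤ) (p.2 : ℤ) else 0)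
      (∑' k : ℕ, h 0 (k : ℤ)) := by
  have hi : Function.Injective (fun k : ℕ => ((0 : ℕ), k)) := by
    intro a b hh
    simpa using hh
  have h1 := (hs.comp_injective hi).hasSum
  rw [← hi.hasSum_iff]
  · simpa [Function.comp_def] using h1
  · rintro ⟨j, k⟩ hp
    cases j with
    | zero => exact absurd ⟨k, rfl⟩ hp
    | succ n => simp

theorem aux_b2 (h : ℤ → ℤ → ℝ)
    (hs : Summable (fun p : ℕ × ℕ => h (p.1 : ℤ) (p.2 : ℤ))) :
    HasSum (fun p : ℕ × ℕ => if p.2 = 0 then h (p.1 : ℤ) (p.2 : ℤ) else 0)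
      (∑' j : ℕ, h (j : ℤ) 0) := by
  have hi : Function.Injective (fun k : ℕ => (k, (0 : ℕ))) := by
    intro a b hh
    simpa using hh
  have h1 := (hs.comp_injective hi).hasSum
  rw [← hi.hasSum_iff]
  · simpa [Function.comp_def] using h1
  · rintro ⟨j, k⟩ hp
    cases k with
    | zero => exact absurd ⟨j, rfl⟩ hp
    | succ n => simp

/-- Nodal form of `2 w`, from the two Laplacians and the four adjacent cells. -/
def auxW (a b X Y NE NW SE SW : ℝ) : ℝ :=
  a ^ 2 * X + b ^ 2 * Y + 2 * a * b * ((NE + NW + SE + SW) / 4)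
    - (a ^ 2 + b ^ 2) / 4 * (NE - NW - SE + SW)

/-- Nodal density of the right-hand side, up to terms which sum to zero. -/
def auxR (a b X Y NE NW SE SW : ℝ) : ℝ :=
  2 * (a ^ 2 + b ^ 2) * (a ^ 2 * X ^ 2 + b ^ 2 * Y ^ 2
    + (a ^ 2 + b ^ 2) * ((NE ^ 2 + NW ^ 2 + SE ^ 2 + SW ^ 2) / 4))
    - a * b * (a ^ 2 + b ^ 2) * (NE ^ 2 + SW ^ 2 - SE ^ 2 - NW ^ 2)

theorem aux_int (a b X Y NE NW SE SW : ℝ) :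
    auxW a b X Y NE NW SE SW ^ 2 ≤ auxR a b X Y NE NW SE SW := by
  have key : auxR a b X Y NE NW SE SW - auxW a b X Y NE NW SE SW ^ 2 =
      (a ^ 2 * X + b ^ 2 * Y + ((a ^ 2 + b ^ 2) / 4 * (NE - NW - SE + SW)
          - 2 * a * b * ((NE + NW + SE + SW) / 4))) ^ 2
        + 2 * (a * b * (X - Y)) ^ 2
        + 2 * ((a ^ 2 - b ^ 2) * ((NE + NW + SE + SW) / 4)) ^ 2
        + (a ^ 2 + b ^ 2) / 2 *
          ((a * ((NE + SE - NW - SW) / 2) - b * ((NE + NW - SE - SW) / 2)) ^ 2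
          + (b * ((NE + SE - NW - SW) / 2) - a * ((NE + NW - SE - SW) / 2)) ^ 2) := by
    unfold auxR auxW
    ring
  have : 0 ≤ auxR a b X Y NE NW SE SW - auxW a b X Y NE NW SE SW ^ 2 := by
    rw [key]; positivity
  linarith

theorem aux_bd1 (a b X Y NE SE : ℝ) :
    auxW a b X Y NE 0 SE 0 ^ 2 + (a ^ 2 + b ^ 2) / 2 * (a ^ 2 * X ^ 2 + b ^ 2 * Y ^ 2)
      ≤ auxR a b X Y NE 0 SE 0 := by
  have key : auxR a b X Y NE 0 SE 0 - (auxW a b X Y NE 0 SE 0 ^ 2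
        + (a ^ 2 + b ^ 2) / 2 * (a ^ 2 * X ^ 2 + b ^ 2 * Y ^ 2)) =
      1 / 2 * (a ^ 2 * X + b ^ 2 * Y + 2 * ((a ^ 2 + b ^ 2) / 4 * (NE - SE)
          - 2 * a * b * ((NE + SE) / 4))) ^ 2
        + ((a ^ 2 + b ^ 2) / 4 * (NE - SE) - 2 * a * b * ((NE + SE) / 4)) ^ 2
        + 3 / 2 * (a * b * (X - Y)) ^ 2
        + 4 * ((a ^ 2 - b ^ 2) * ((NE + SE) / 4)) ^ 2 := by
    unfold auxR auxW
    ring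
  have : 0 ≤ auxR a b X Y NE 0 SE 0 - (auxW a b X Y NE 0 SE 0 ^ 2
        + (a ^ 2 + b ^ 2) / 2 * (a ^ 2 * X ^ 2 + b ^ 2 * Y ^ 2)) := by
    rw [key]; positivity
  linarith

theorem aux_bd2 (a b X Y NE NW : ℝ) :
    auxW a b X Y NE NW 0 0 ^ 2 + (a ^ 2 + b ^ 2) / 2 * (a ^ 2 * X ^ 2 + b ^ 2 * Y ^ 2)
      ≤ auxR a b X Y NE NW 0 0 := by
  have h := aux_bd1 b a Y X NE NW
  have e1 : auxW b a Y X NE 0 NW 0 = auxW a b X Y NE NW 0 0 := by unfold auxW; ring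
  have e2 : auxR b a Y X NE 0 NW 0 = auxR a b X Y NE NW 0 0 := by unfold auxR; ring
  rw [e1, e2] at h
  linarith

/-- Proposition 3: bound on `4‖w‖²` in the quarter-space, with boundary gains
on both sides of the boundary. -/
theorem quarterspace_prop3 (α β : ℝ) (u : ℤ → ℤ → ℝ) (hu : memQ u) :
    4 * sqQ (wop α β u)
        + β ^ 2 * ((α ^ 2 + β ^ 2) / 2) * (∑' k : ℕ, (L2 u 0 (k : ℤ)) ^ 2)
        + α ^ 2 * ((α ^ 2 + β ^ 2) / 2) * (∑' j : ℕ, (L1 u (j : ℤ) 0) ^ 2) ≤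
      2 * (α ^ 2 + β ^ 2) *
        (α ^ 2 * sqQ (L1 u) + β ^ 2 * sqQ (L2 u)
          + (α ^ 2 + β ^ 2) * sqQ (D1p (D2p u))) := by
  obtain ⟨hb1, hb2, hs⟩ := hu
  have hD1 : Summable (fun p : ℕ × ℕ => (D1p u (p.1 : ℤ) (p.2 : ℤ)) ^ 2) :=
    aux_sub _ _ (aux_up1 (fun j k => u j k ^ 2) hs) hs
  have hD2 : Summable (fun p : ℕ × ℕ => (D2p u (p.1 : ℤ) (p.2 : ℤ)) ^ 2) :=
    aux_sub _ _ (aux_up2 (fun j k => u j k ^ 2) hs) hs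
  have hr : Summable (fun p : ℕ × ℕ => (D1p (D2p u) (p.1 : ℤ) (p.2 : ℤ)) ^ 2) :=
    aux_sub _ _ (aux_up1 (fun j k => D2p u j k ^ 2) hD2) hD2
  have z1 : ∀ k : ℤ, -1 ≤ k → D1p u (-1) k = 0 := by
    intro k hk
    simp [D1p, hb1 k hk]
  have z2 : ∀ j : ℤ, 0 ≤ j → D2p u j (-1) = 0 := by
    intro j hj
    simp [D2p, hb2 j hj]
  have r1 : ∀ k : ℤ, -1 ≤ k → D1p (D2p u) (-1) k = 0 := by
    intro k hk
    simp [D1p, D2p, hb1 k hk, hb1 (k + 1) (by omega)]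
  have r2 : ∀ j : ℤ, 0 ≤ j → D1p (D2p u) j (-1) = 0 := by
    intro j hj
    simp [D1p, D2p, hb2 j hj, hb2 (j + 1) (by omega)]
  have hX : Summable (fun p : ℕ × ℕ => (L1 u (p.1 : ℤ) (p.2 : ℤ)) ^ 2) := by
    have h := aux_sub _ _ hD1 (aux_shift1 (fun j k => D1p u j k ^ 2) _
      (fun k => by simp [z1 k (by omega)]) hD1.hasSum).summable
    convert h using 3 with p
    simp [L1, D1p, D1m]
  have hY : Summable (fun p : ℕ × ℕ => (L2 u (p.1 : ℤ) (p.2 : ℤ)) ^ 2) := by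
    have h := aux_sub _ _ hD2 (aux_shift2 (fun j k => D2p u j k ^ 2) _
      (fun j => by simp [z2 j (by omega)]) hD2.hasSum).summable
    convert h using 3 with p
    simp [L2, D2p, D2m]
  have hNE := hr.hasSum
  have hNW := aux_shift1 (fun j k => D1p (D2p u) j k ^ 2) _
      (fun k => by simp [r1 k (by omega)]) hNE
  have hSE := aux_shift2 (fun j k => D1p (D2p u) j k ^ 2) _
      (fun j => by simp [r2 j (by omega)]) hNE
  have hSW := aux_shift1 (fun j k => D1p (D2p u) j (k - 1) ^ 2) _
      (fun k => by simp [r1 ((k : ℤ) - 1) (by omega)]) hSE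
  have hB1 := aux_b1 (fun j k => L2 u j k ^ 2) hY
  have hB2 := aux_b2 (fun j k => L1 u j k ^ 2) hX
  have hw : ∀ j k : ℤ, 4 * wop α β u j k ^ 2 = auxW α β (L1 u j k) (L2 u j k)
      (D1p (D2p u) j k) (D1p (D2p u) (j - 1) k) (D1p (D2p u) j (k - 1))
      (D1p (D2p u) (j - 1) (k - 1)) ^ 2 := by
    intro j k
    have : -2 * wop α β u j k = auxW α β (L1 u j k) (L2 u j k)
      (D1p (D2p u) j k) (D1p (D2p u) (j - 1) k) (D1p (D2p u) j (k - 1))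
      (D1p (D2p u) (j - 1) (k - 1)) := by
      simp only [wop, auxW, L1, L2, D10, D20, D1p, D1m, D2p, D2m, sub_add_cancel,
        add_sub_cancel_right]
      ring
    rw [← this]; ring
  have hR : HasSum (fun p : ℕ × ℕ => auxR α β (L1 u p.1 p.2) (L2 u p.1 p.2)
      (D1p (D2p u) p.1 p.2) (D1p (D2p u) ((p.1 : ℤ) - 1) p.2)
      (D1p (D2p u) p.1 ((p.2 : ℤ) - 1)) (D1p (D2p u) ((p.1 : ℤ) - 1) ((p.2 : ℤ) - 1)))
      (2 * (α ^ 2 + β ^ 2) *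
        (α ^ 2 * sqQ (L1 u) + β ^ 2 * sqQ (L2 u)
          + (α ^ 2 + β ^ 2) * sqQ (D1p (D2p u)))) := by
    have h := ((((hX.hasSum.mul_left (α ^ 2)).add (hY.hasSum.mul_left (β ^ 2))).add
      (((((hNE.add hNW).add hSE).add hSW).div_const 4).mul_left (α ^ 2 + β ^ 2))).mul_left
        (2 * (α ^ 2 + β ^ 2))).sub
      ((((hNE.add hSW).sub hSE).sub hNW).mul_left (α * β * (α ^ 2 + β ^ 2)))
    refine aux_val h ?_
    unfold sqQ
    ring
  have hpt : ∀ p : ℕ × ℕ, 4 * wop α β u p.1 p.2 ^ 2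
      + β ^ 2 * ((α ^ 2 + β ^ 2) / 2) * (if p.1 = 0 then L2 u p.1 p.2 ^ 2 else 0)
      + α ^ 2 * ((α ^ 2 + β ^ 2) / 2) * (if p.2 = 0 then L1 u p.1 p.2 ^ 2 else 0) ≤
      auxR α β (L1 u p.1 p.2) (L2 u p.1 p.2)
      (D1p (D2p u) p.1 p.2) (D1p (D2p u) ((p.1 : ℤ) - 1) p.2)
      (D1p (D2p u) p.1 ((p.2 : ℤ) - 1)) (D1p (D2p u) ((p.1 : ℤ) - 1) ((p.2 : ℤ) - 1)) := by
    rintro ⟨j, k⟩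
    rw [hw]
    dsimp only
    have pX : 0 ≤ α ^ 2 * ((α ^ 2 + β ^ 2) / 2) * L1 u j k ^ 2 := by positivity
    have pY : 0 ≤ β ^ 2 * ((α ^ 2 + β ^ 2) / 2) * L2 u j k ^ 2 := by positivity
    by_cases hj : j = 0
    · have e1 : D1p (D2p u) ((j : ℤ) - 1) k = 0 := by
        subst hj; simpa using r1 k (by omega)
      have e2 : D1p (D2p u) ((j : ℤ) - 1) ((k : ℤ) - 1) = 0 := by
        subst hj; simpa using r1 ((k : ℤ) - 1) (by omega)
      rw [e1, e2, if_pos hj]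
      have h := aux_bd1 α β (L1 u j k) (L2 u j k) (D1p (D2p u) j k)
        (D1p (D2p u) j ((k : ℤ) - 1))
      split_ifs <;> linarith
    · rw [if_neg hj]
      by_cases hk : k = 0
      · have e1 : D1p (D2p u) j ((k : ℤ) - 1) = 0 := by
          subst hk; simpa using r2 j (by omega)
        have e2 : D1p (D2p u) ((j : ℤ) - 1) ((k : ℤ) - 1) = 0 := by
          subst hk; simpa using r2 ((j : ℤ) - 1) (by omega)
        rw [e1, e2, if_pos hk]
        have h := aux_bd2 α β (L1 u j k) (L2 u j k) (D1p (D2p u) j k)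
          (D1p (D2p u) ((j : ℤ) - 1) k)
        linarith
      · rw [if_neg hk]
        simpa using aux_int α β _ _ _ _ _ _
  have hW : Summable (fun p : ℕ × ℕ => (wop α β u (p.1 : ℤ) (p.2 : ℤ)) ^ 2) := by
    refine Summable.of_nonneg_of_le (fun _ => sq_nonneg _) (fun p => ?_) hR.summable
    refine le_trans ?_ (aux_int α β _ _ _ _ _ _)
    rw [← hw]
    nlinarith [sq_nonneg (wop α β u p.1 p.2)]
  exact hasSum_le hpt (((hW.hasSum.mul_left 4).add (hB1.mul_left _)).add (hB2.mul_left _)) hR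
end
end
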